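/- For every α ∈ (0,2], c > 0, a > 0, t > 0 and 0 < r ≤ s, the covariance of the counting functions over nested intervals satisfies ∑__{j∈ℤ} ∫₀¹ ( q_j(ε; r) − q_j(ε; r)·q_j(ε; s) ) dε = (1/2)( V_t^{α,c,a}[r] + V_t^{α,c,a}[s] − V_t^{α,c,a}[s−r] ), where q_j(ε; x) := ∫₀^x p_t^{α,c}(y − a(j−ε)) dy and V_t^{α,c,a}[L] := ∑_{j∈ℤ} ∫₀¹ q_j(ε; L)(1 − q_j(ε; L)) dε (with V_t^{α,c,a}[0] := 0). -/

import Mathlib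

open MeasureTheory Filter Set

/-- Symmetric `α`-stable transition density at time `t`, defined by Fourier inversion. -/
noncomputable def stablePDF (α c t z : ℝ) : ℝ :=
  (1 / Real.pi) * ∫ θ in Set.Ioi (0:ℝ), Real.cos (z * θ) * Real.exp (-(c * t * θ ^ α))

/-- Probability that the `j`-th particle, started from `a (j - ε)`,
lies in `[0, x]` at time `t`. -/
noncomputable def hitProb (α c t a : ℝ) (j : ℤ) (ε x : ℝ) : ℝ :=
  ∫ y in (0:ℝ)..x, stablePDF α c t (y - a * ((j : ℝ) - ε))

/-- The averaged number variance, expressed directly via the particle system. -/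
noncomputable def numVar (α c t a L : ℝ) : ℝ :=
  ∑' j : ℤ, ∫ ε in (0:ℝ)..1, hitProb α c t a j ε L * (1 - hitProb α c t a j ε L)

lemma one_sub_cos_le_two_mul_rpow {x β : ℝ} (hx : 0 ≤ x) (hβ0 : 0 ≤ β) (hβ : β ≤ 2) :
    1 - Real.cos x ≤ 2 * x ^ β := by
  rcases le_total 1 x with h | h
  · have := Real.one_le_rpow h hβ0
    linarith [Real.neg_one_le_cos x]
  · rcases hx.eq_or_lt with rfl | hx'
    · simpa using Real.rpow_nonneg le_rfl β
    · have h1 : x ^ (2 : ℝ) ≤ x ^ β := Real.rpow_le_rpow_of_exponent_ge hx' h hβ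
      rw [Real.rpow_two] at h1
      nlinarith [Real.one_sub_sq_div_two_le_cos (x := x), sq_nonneg x]

/-- Second derivative of the characteristic function `θ ↦ exp (-k θ ^ α)` on `θ > 0`. -/
noncomputable def stableCharFunDeriv2 (α k θ : ℝ) : ℝ :=
  (-(k * α * (α - 1))) * (θ ^ (α - 2) * Real.exp (-k * θ ^ α)) +
    (k * α) ^ 2 * (θ ^ (2 * α - 2) * Real.exp (-k * θ ^ α))

lemma integrableOn_rpow_mul_stableCharFunDeriv2 {α k β : ℝ} (hα : 0 < α) (hk : 0 < k)
    (hβ : 1 - α < β) :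
    IntegrableOn (fun θ : ℝ => θ ^ β * stableCharFunDeriv2 α k θ) (Ioi 0) := by
  have h1 := (integrableOn_rpow_mul_exp_neg_mul_rpow (p := α) (s := β + (α - 2)) (b := k)
    (by linarith) hα hk).const_mul (-(k * α * (α - 1)))
  have h2 := (integrableOn_rpow_mul_exp_neg_mul_rpow (p := α) (s := β + (2 * α - 2)) (b := k)
    (by linarith) hα hk).const_mul ((k * α) ^ 2)
  refine IntegrableOn.congr_fun (h1.add h2) (fun θ hθ => ?_) measurableSet_Ioi
  have hθ' : 0 < θ := hθ
  simp only [stableCharFunDeriv2, Pi.add_apply, Real.rpow_add hθ']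
  ring

lemma integrableOn_exp_neg_mul_rpow {α k : ℝ} (hα : 0 < α) (hk : 0 < k) :
    IntegrableOn (fun θ : ℝ => Real.exp (-(k * θ ^ α))) (Ioi 0) := by
  simpa using integrableOn_rpow_mul_exp_neg_mul_rpow (p := α) (s := 0) (b := k)
    (by norm_num) hα hk

lemma tendsto_rpow_mul_exp_neg_mul_rpow_atTop {α k : ℝ} (s : ℝ) (hα : 0 < α) (hk : 0 < k) :
    Tendsto (fun θ : ℝ => θ ^ s * Real.exp (-k * θ ^ α)) atTop (nhds 0) := by
  have h := (tendsto_rpow_mul_exp_neg_mul_atTop_nhds_zero (s / α) k hk).comp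
    (tendsto_rpow_atTop hα)
  refine h.congr' ?_
  filter_upwards [eventually_gt_atTop 0] with θ hθ
  simp only [Function.comp_apply]
  rw [← Real.rpow_mul hθ.le, mul_div_cancel₀ _ hα.ne']

lemma integrableOn_cos_mul_exp_neg_mul_rpow {α k : ℝ} (z : ℝ) (hα : 0 < α) (hk : 0 < k) :
    IntegrableOn (fun θ : ℝ => Real.cos (z * θ) * Real.exp (-(k * θ ^ α))) (Ioi 0) :=
  Integrable.bdd_mul (c := 1) (integrableOn_exp_neg_mul_rpow hα hk)
    (by fun_prop) (Eventually.of_forall fun θ => Real.abs_cos_le_one _)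

lemma norm_one_sub_cos_div_sq_mul_le {z θ w β : ℝ} (hz : 0 < z) (hθ : 0 < θ) (hβ0 : 0 ≤ β)
    (hβ : β ≤ 2) :
    ‖(1 - Real.cos (z * θ)) / z ^ 2 * w‖ ≤ 2 * z ^ (β - 2) * ‖θ ^ β * w‖ := by
  have h0 : 0 ≤ 1 - Real.cos (z * θ) := by linarith [Real.cos_le_one (z * θ)]
  have h1 := one_sub_cos_le_two_mul_rpow (mul_pos hz hθ).le hβ0 hβ
  rw [Real.mul_rpow hz.le hθ.le] at h1
  rw [norm_mul, norm_mul, Real.norm_of_nonneg (by positivity),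
    Real.norm_of_nonneg (Real.rpow_nonneg hθ.le β), Real.rpow_sub hz, Real.rpow_two]
  calc (1 - Real.cos (z * θ)) / z ^ 2 * ‖w‖ ≤ 2 * (z ^ β * θ ^ β) / z ^ 2 * ‖w‖ := by gcongr
    _ = _ := by ring

/-- Integrating by parts twice in the Fourier inversion integral. -/
lemma integral_cos_mul_exp_neg_mul_rpow {α k z : ℝ} (hα : 0 < α) (hα2 : α ≤ 2) (hk : 0 < k)
    (hz : 0 < z) :
    ∫ θ in Ioi (0 : ℝ), Real.cos (z * θ) * Real.exp (-(k * θ ^ α)) =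
      ∫ θ in Ioi (0 : ℝ), (1 - Real.cos (z * θ)) / z ^ 2 * stableCharFunDeriv2 α k θ := by
  have hint1 := integrableOn_cos_mul_exp_neg_mul_rpow z hα hk
  have hint2 : IntegrableOn
      (fun θ : ℝ => (1 - Real.cos (z * θ)) / z ^ 2 * stableCharFunDeriv2 α k θ) (Ioi 0) := by
    have hb := integrableOn_rpow_mul_stableCharFunDeriv2 (β := 1 - α / 2) hα hk (by linarith)
    refine Integrable.mono' (hb.norm.const_mul (2 * z ^ (1 - α / 2 - 2))) ?_ ?_
    · refine Measurable.aestronglyMeasurable ?_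
      unfold stableCharFunDeriv2
      fun_prop
    · filter_upwards [ae_restrict_mem measurableSet_Ioi] with θ hθ
      exact norm_one_sub_cos_div_sq_mul_le hz hθ (by linarith) (by linarith)
  have key : ∫ θ in Ioi (0 : ℝ), (Real.cos (z * θ) * Real.exp (-(k * θ ^ α)) -
      (1 - Real.cos (z * θ)) / z ^ 2 * stableCharFunDeriv2 α k θ) = 0 := by
    have := integral_Ioi_of_hasDerivAt_of_tendsto (a := 0) (m := 0)
      (f := fun θ : ℝ => Real.sin (z * θ) / z * Real.exp (-k * θ ^ α) +
        (1 - Real.cos (z * θ)) / z ^ 2 * ((k * α) * (θ ^ (α - 1) * Real.exp (-k * θ ^ α))))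
      (f' := fun θ => Real.cos (z * θ) * Real.exp (-(k * θ ^ α)) -
        (1 - Real.cos (z * θ)) / z ^ 2 * stableCharFunDeriv2 α k θ) ?_ ?_
        (hint1.sub hint2) ?_
    · simpa using this
    · have hcont : ContinuousWithinAt
          (fun θ : ℝ => Real.sin (z * θ) / z * Real.exp (-k * θ ^ α)) (Ici 0) 0 := by
        have : Continuous (fun θ : ℝ => θ ^ α) := Real.continuous_rpow_const hα.le
        exact Continuous.continuousWithinAt (by fun_prop)
      refine hcont.add ?_
      have hlim : Tendsto (fun θ : ℝ => (k * α) / 2 * θ ^ (α + 1)) (nhdsWithin 0 (Ici 0))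
          (nhds 0) := by
        have : Continuous (fun θ : ℝ => (k * α) / 2 * θ ^ (α + 1)) :=
          continuous_const.mul (Real.continuous_rpow_const (by linarith))
        have h := (this.tendsto 0).mono_left (nhdsWithin_le_nhds (s := Ici 0))
        simpa [Real.zero_rpow (by linarith : α + 1 ≠ 0)] using h
      have h0 : (1 - Real.cos (z * 0)) / z ^ 2 *
          ((k * α) * ((0 : ℝ) ^ (α - 1) * Real.exp (-k * 0 ^ α))) = 0 := by simp
      rw [ContinuousWithinAt, h0]
      refine squeeze_zero_norm' ?_ hlim
      filter_upwards [self_mem_nhdsWithin] with θ hθ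
      rcases (show (0 : ℝ) ≤ θ from hθ).eq_or_lt with rfl | hθ'
      · rw [h0]; simp [Real.zero_rpow (by linarith : α + 1 ≠ 0)]
      · have hc0 : 0 ≤ 1 - Real.cos (z * θ) := by linarith [Real.cos_le_one (z * θ)]
        rw [Real.norm_of_nonneg (by positivity)]
        have hc1 : 1 - Real.cos (z * θ) ≤ (z * θ) ^ 2 / 2 := by
          linarith [Real.one_sub_sq_div_two_le_cos (x := z * θ)]
        have he : Real.exp (-k * θ ^ α) ≤ 1 := by
          rw [Real.exp_le_one_iff]
          have : 0 ≤ k * θ ^ α := by positivity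
          linarith
        calc _ ≤ (z * θ) ^ 2 / 2 / z ^ 2 * ((k * α) * (θ ^ (α - 1) * 1)) := by gcongr
          _ = _ := by
            rw [show α + 1 = (α - 1) + 2 by ring, Real.rpow_add hθ', Real.rpow_two]
            field_simp
    · intro θ hθ
      have hθ' : 0 < θ := hθ
      have hp : HasDerivAt (fun θ : ℝ => θ ^ α) (α * θ ^ (α - 1)) θ :=
        Real.hasDerivAt_rpow_const (Or.inl hθ'.ne')
      have hp1 : HasDerivAt (fun θ : ℝ => θ ^ (α - 1)) ((α - 1) * θ ^ (α - 1 - 1)) θ :=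
        Real.hasDerivAt_rpow_const (Or.inl hθ'.ne')
      have hE := (hp.const_mul (-k)).exp
      have hl : HasDerivAt (fun θ : ℝ => z * θ) z θ := by
        simpa using (hasDerivAt_id θ).const_mul z
      have h := ((hl.sin.div_const z).mul hE).add
        (((hl.cos.const_sub 1).div_const (z ^ 2)).mul ((hp1.mul hE).const_mul (k * α)))
      refine h.congr_deriv ?_
      have e1 : θ ^ (2 * α - 2) = θ ^ (α - 1) * θ ^ (α - 1) := by
        rw [← Real.rpow_add hθ']; ring_nf
      have e2 : α - 1 - 1 = α - 2 := by ring
      simp only [stableCharFunDeriv2, e1, e2, neg_mul, Pi.mul_apply]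
      field_simp
      ring
    · have t0 := tendsto_rpow_mul_exp_neg_mul_rpow_atTop (α := α) (k := k) 0 hα hk
      have t1 := tendsto_rpow_mul_exp_neg_mul_rpow_atTop (α := α) (k := k) (α - 1) hα hk
      simp only [Real.rpow_zero, one_mul] at t0
      have s0 : Tendsto (fun θ : ℝ => Real.sin (z * θ) / z * Real.exp (-k * θ ^ α)) atTop
          (nhds 0) := by
        refine squeeze_zero_norm (fun θ => ?_) (by simpa using t0.const_mul (1 / z))
        rw [norm_mul, Real.norm_of_nonneg (Real.exp_pos _).le, norm_div, Real.norm_of_nonneg hz.le,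
          ← neg_mul]
        gcongr
        simpa using div_le_div_of_nonneg_right (Real.abs_sin_le_one (z * θ)) hz.le
      have s1 : Tendsto (fun θ : ℝ => (1 - Real.cos (z * θ)) / z ^ 2 *
          ((k * α) * (θ ^ (α - 1) * Real.exp (-k * θ ^ α)))) atTop (nhds 0) := by
        refine squeeze_zero_norm' ?_ (by simpa using t1.const_mul (2 / z ^ 2 * (k * α)))
        filter_upwards [eventually_gt_atTop 0] with θ hθ
        have hc0 : 0 ≤ 1 - Real.cos (z * θ) := by linarith [Real.cos_le_one (z * θ)]
        rw [Real.norm_of_nonneg (by positivity), mul_assoc (2 / z ^ 2), ← neg_mul]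
        have hc2 : 1 - Real.cos (z * θ) ≤ 2 := by linarith [Real.neg_one_le_cos (z * θ)]
        gcongr
      simpa using s0.add s1
  rw [integral_sub hint1 hint2] at key
  linarith

lemma continuous_stablePDF {α c t : ℝ} (hα : 0 < α) (hct : 0 < c * t) :
    Continuous (stablePDF α c t) := by
  unfold stablePDF
  refine continuous_const.mul ?_
  refine continuous_of_dominated (bound := fun θ : ℝ => Real.exp (-(c * t * θ ^ α)))
    (fun z => (integrableOn_cos_mul_exp_neg_mul_rpow z hα hct).aestronglyMeasurable)
    (fun z => Eventually.of_forall fun θ => ?_) (integrableOn_exp_neg_mul_rpow hα hct)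
    (Eventually.of_forall fun θ => by fun_prop)
  rw [norm_mul, Real.norm_of_nonneg (Real.exp_pos _).le]
  exact mul_le_of_le_one_left (Real.exp_pos _).le (Real.abs_cos_le_one _)

lemma stablePDF_neg (α c t z : ℝ) : stablePDF α c t (-z) = stablePDF α c t z := by
  simp only [stablePDF, neg_mul, Real.cos_neg]

lemma integrable_stablePDF {α c t : ℝ} (hα : 0 < α) (hα2 : α ≤ 2) (hct : 0 < c * t) :
    Integrable (stablePDF α c t) := by
  refine (continuous_stablePDF hα hct).locallyIntegrable
    |>.integrable_of_isBigO_atTop_of_norm_isNegInvariant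
      (g := fun z : ℝ => z ^ (1 - α / 2 - 2)) ?_ ?_ ?_
  · exact Eventually.of_forall fun z => by simp [stablePDF_neg]
  · have hb := integrableOn_rpow_mul_stableCharFunDeriv2 (β := 1 - α / 2) hα hct (by linarith)
    refine Asymptotics.IsBigO.of_bound ((1 / Real.pi) *
      (2 * ∫ θ in Ioi (0 : ℝ), ‖θ ^ (1 - α / 2) * stableCharFunDeriv2 α (c * t) θ‖)) ?_
    filter_upwards [eventually_gt_atTop 0] with z hz
    rw [stablePDF, integral_cos_mul_exp_neg_mul_rpow hα hα2 hct hz, norm_mul,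
      Real.norm_of_nonneg (by positivity : 0 ≤ 1 / Real.pi),
      Real.norm_of_nonneg (Real.rpow_nonneg hz.le _), mul_assoc]
    gcongr
    rw [mul_right_comm, ← integral_const_mul]
    refine norm_integral_le_of_norm_le (hb.norm.const_mul _) ?_
    filter_upwards [ae_restrict_mem measurableSet_Ioi] with θ hθ
    exact norm_one_sub_cos_div_sq_mul_le hz hθ (by linarith) (by linarith)
  · exact ⟨Ioi 1, Ioi_mem_atTop 1,
      integrableOn_Ioi_rpow_of_lt (by linarith) one_pos⟩

lemma integrable_intervalIntegral_comp_sub {p : ℝ → ℝ} (hp : Integrable p) {L : ℝ}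
    (hL : 0 ≤ L) : Integrable fun u : ℝ => ∫ y in (0 : ℝ)..L, p (y - u) := by
  have hf : Integrable ((Ioc 0 L).indicator fun _ : ℝ => (1 : ℝ)) :=
    (integrable_indicator_iff measurableSet_Ioc).2 (by simp)
  have h := hf.integrable_convolution (ContinuousLinearMap.mul ℝ ℝ) hp.comp_neg
  refine h.congr (Eventually.of_forall fun u => ?_)
  simp only [convolution, ContinuousLinearMap.mul_apply', neg_sub]
  rw [intervalIntegral.integral_of_le hL, ← integral_indicator measurableSet_Ioc]
  congr 1 with y
  by_cases hy : y ∈ Ioc 0 L <;> simp [hy]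

lemma norm_intervalIntegral_comp_sub_le {p : ℝ → ℝ} (hp : Integrable p) (L u : ℝ) :
    ‖∫ y in (0 : ℝ)..L, p (y - u)‖ ≤ ∫ y, ‖p y‖ := by
  refine intervalIntegral.norm_integral_le_integral_norm_uIoc.trans ?_
  rw [← integral_sub_right_eq_self (fun y => ‖p y‖) u]
  exact setIntegral_le_integral (hp.comp_sub_right u).norm
    (Eventually.of_forall fun _ => norm_nonneg _)

/-- Averaging the lattice `a ℤ` over a uniform shift turns sums into integrals. -/
lemma hasSum_integral_lattice {f : ℝ → ℝ} (hf : Integrable f) {a : ℝ} (ha : 0 < a) :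
    HasSum (fun j : ℤ => ∫ ε in (0 : ℝ)..1, f (a * ((j : ℝ) - ε))) (a⁻¹ * ∫ u, f u) := by
  have h := (hf.comp_mul_left' (neg_ne_zero.2 ha.ne')).hasSum_intervalIntegral_comp_add_int
  rw [Measure.integral_comp_mul_left, abs_inv, abs_neg, abs_of_pos ha, smul_eq_mul] at h
  refine ((Equiv.neg ℤ).hasSum_iff.2 h).congr_fun ?_
  intro j
  simp only [Function.comp_apply, Equiv.neg_apply]
  congr 1 with ε
  push_cast
  ring_nf

theorem counting_covariance_formula (α c a t r s : ℝ) (hα : α ∈ Set.Ioc (0:ℝ) 2)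
    (hc : 0 < c) (ha : 0 < a) (ht : 0 < t) (hr : 0 < r) (hrs : r ≤ s) :
    (∑' j : ℤ, ∫ ε in (0:ℝ)..1,
        (hitProb α c t a j ε r - hitProb α c t a j ε r * hitProb α c t a j ε s)) =
      (1 / 2) * (numVar α c t a r + numVar α c t a s - numVar α c t a (s - r)) := by
  obtain ⟨hα0, hα2⟩ := hα
  have hp := integrable_stablePDF hα0 hα2 (mul_pos hc ht)
  set Q : ℝ → ℝ → ℝ := fun x u => ∫ y in (0 : ℝ)..x, stablePDF α c t (y - u) with hQ
  have hQi : ∀ x, 0 ≤ x → Integrable (Q x) := fun x hx =>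
    integrable_intervalIntegral_comp_sub hp hx
  have hQQ : ∀ x y, 0 ≤ x → 0 ≤ y → Integrable fun u => Q x u * Q y u := fun x y hx hy =>
    (hQi y hy).bdd_mul (hQi x hx).aestronglyMeasurable
      (Eventually.of_forall fun u => norm_intervalIntegral_comp_sub_le hp x u)
  have hVi : ∀ x, 0 ≤ x → Integrable fun u => Q x u * (1 - Q x u) := fun x hx =>
    ((hQi x hx).sub (hQQ x x hx hx)).congr (Eventually.of_forall fun u => by
      simp only [Pi.sub_apply]; ring)
  have hV : ∀ x, 0 ≤ x → numVar α c t a x = a⁻¹ * ∫ u, Q x u * (1 - Q x u) := fun x hx =>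
    (hasSum_integral_lattice (hVi x hx) ha).tsum_eq
  have hs : 0 ≤ s := hr.le.trans hrs
  have hd : 0 ≤ s - r := sub_nonneg.2 hrs
  have hcov : (∑' j : ℤ, ∫ ε in (0:ℝ)..1,
        (hitProb α c t a j ε r - hitProb α c t a j ε r * hitProb α c t a j ε s)) =
      a⁻¹ * ∫ u, (Q r u - Q r u * Q s u) :=
    (hasSum_integral_lattice ((hQi r hr.le).sub (hQQ r s hr.le hs)) ha).tsum_eq
  have hsplit : ∀ u, Q s u = Q r u + Q (s - r) (u - r) := by
    intro u
    have hii : ∀ x y, IntervalIntegrable (fun y => stablePDF α c t (y - u)) volume x y :=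
      fun x y => (hp.comp_sub_right u).intervalIntegrable
    have hshift : Q (s - r) (u - r) = ∫ y in r..s, stablePDF α c t (y - u) := by
      have h := intervalIntegral.integral_comp_add_right (a := 0) (b := s - r)
        (fun y => stablePDF α c t (y - u)) r
      rw [zero_add, sub_add_cancel] at h
      rw [← h]
      simp only [hQ]
      congr 1 with y
      ring_nf
    rw [hshift]
    exact (intervalIntegral.integral_add_adjacent_intervals (hii 0 r) (hii r s)).symm
  rw [hcov, hV r hr.le, hV s hs, hV (s - r) hd,
    ← integral_sub_right_eq_self (fun u => Q (s - r) u * (1 - Q (s - r) u)) r,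
    ← mul_add, ← mul_sub, ← integral_add (hVi r hr.le) (hVi s hs),
    ← integral_sub (by exact (hVi r hr.le).add (hVi s hs)) ((hVi (s - r) hd).comp_sub_right r),
    mul_left_comm, ← integral_const_mul (1 / 2 : ℝ)]
  congr 2 with u
  rw [hsplit u]
  ring
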